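/- arXiv:2012.12216 — 3 statements merged into one kernel-verified Lean document; each statement's English description precedes it below -/
import Mathlib

section
/- Let K \subseteq \R^n be a centrally symmetric convex set (identified with its 0/1 indicator function), and let v \in \R^n be a unit vector. Then Inf_v[K] := E_{x \sim N(0,1)^n}[-K(x) \cdot ((\langle x, v \rangle^2 - 1)/\sqrt{2})] \ge 0. -/
open MeasureTheory ProbabilityTheory

/-- The standard Gaussian measure `N(0,1)^n` on `ℝ^n`. -/
noncomputable def stdGaussian (n : ℕ) : Measure (Fin n → ℝ) :=
  Measure.pi fun _ => gaussianReal 0 1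

open scoped ENNReal

theorem volume_add_volume_le_of_isCompact {A B C : Set ℝ} (hA : IsCompact A) (hB : IsCompact B)
    (hA₀ : A.Nonempty) (hB₀ : B.Nonempty) (hC : ∀ x ∈ A, ∀ y ∈ B, 2⁻¹ * (x + y) ∈ C) :
    volume A + volume B ≤ 2 * volume C := by
  obtain ⟨a, haA, ha⟩ := hA.exists_isGreatest hA₀
  obtain ⟨b, hbB, hb⟩ := hB.exists_isLeast hB₀
  have hdisj : AEDisjoint volume ((fun x => x + b) '' A) ((fun y => a + y) '' B) := by
    refine measure_mono_null (t := {a + b}) ?_ (by simp)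
    rintro _ ⟨⟨x, hx, rfl⟩, y, hy, hxy⟩
    have := ha hx
    have := hb hy
    simp only [Set.mem_singleton_iff] at *
    linarith
  have hsub : ((fun x => x + b) '' A) ∪ ((fun y => a + y) '' B) ⊆ (fun z => 2⁻¹ * z) ⁻¹' C := by
    rintro _ (⟨x, hx, rfl⟩ | ⟨y, hy, rfl⟩)
    · exact hC x hx b hbB
    · exact hC a haA y hy
  calc volume A + volume B
      = volume ((fun x => x + b) '' A) + volume ((fun y => a + y) '' B) := by simp
    _ = volume (((fun x => x + b) '' A) ∪ ((fun y => a + y) '' B)) :=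
        (measure_union₀ (hB.image (by fun_prop)).measurableSet.nullMeasurableSet hdisj).symm
    _ ≤ volume ((fun z => 2⁻¹ * z) ⁻¹' C) := measure_mono hsub
    _ = 2 * volume C := by
        rw [Real.volume_preimage_mul_left (by norm_num)]
        norm_num

/-- The Brunn–Minkowski inequality for midpoints on the real line. -/
theorem volume_add_volume_le_two_mul {A B C : Set ℝ} (hA : MeasurableSet A)
    (hB : MeasurableSet B) (hA₀ : A.Nonempty) (hB₀ : B.Nonempty)
    (hC : ∀ x ∈ A, ∀ y ∈ B, 2⁻¹ * (x + y) ∈ C) :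
    volume A + volume B ≤ 2 * volume C := by
  have compact_left : ∀ A' ⊆ A, IsCompact A' → A'.Nonempty →
      volume A' + volume B ≤ 2 * volume C := by
    intro A' hA' hc hne
    obtain ⟨b, hb⟩ := hB₀
    have : volume B ≤ 2 * volume C - volume A' := by
      rw [hB.measure_eq_iSup_isCompact]
      refine iSup₂_le fun B' hB' => iSup_le fun hBc => ?_
      refine ENNReal.le_sub_of_add_le_left hc.measure_ne_top ?_
      calc volume A' + volume B' ≤ volume A' + volume (insert b B') := by
            gcongr; exact Set.subset_insert _ _
        _ ≤ 2 * volume C := volume_add_volume_le_of_isCompact hc (hBc.insert b) hne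
            (Set.insert_nonempty _ _)
            fun x hx y hy => hC x (hA' hx) y (Set.insert_subset hb hB' hy)
    obtain ⟨a, ha⟩ := hne
    have h' : volume A' ≤ 2 * volume C := by
      refine le_self_add.trans (volume_add_volume_le_of_isCompact hc
        (isCompact_singleton (x := b)) ⟨a, ha⟩ (Set.singleton_nonempty b) fun x hx y hy => ?_)
      rw [Set.mem_singleton_iff.1 hy]
      exact hC x (hA' hx) b hb
    calc volume A' + volume B ≤ volume A' + (2 * volume C - volume A') := by gcongr
      _ = 2 * volume C := add_tsub_cancel_of_le h'
  obtain ⟨a, ha⟩ := hA₀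
  have hB_le : volume B ≤ 2 * volume C := by
    simpa using compact_left {a} (by simpa using ha) isCompact_singleton (by simp)
  by_cases hBtop : volume B = ∞
  · rw [hBtop, top_le_iff] at hB_le
    simp [hB_le]
  have : volume A ≤ 2 * volume C - volume B := by
    rw [hA.measure_eq_iSup_isCompact]
    refine iSup₂_le fun A' hA' => iSup_le fun hAc => ?_
    refine ENNReal.le_sub_of_add_le_right hBtop ?_
    calc volume A' + volume B ≤ volume (insert a A') + volume B := by
          gcongr; exact Set.subset_insert _ _
      _ ≤ 2 * volume C :=
          compact_left _ (Set.insert_subset ha hA') (hAc.insert a) (Set.insert_nonempty _ _)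
  calc volume A + volume B ≤ (2 * volume C - volume B) + volume B := by gcongr
    _ = 2 * volume C := tsub_add_cancel_of_le hB_le

theorem lintegral_eq_setLIntegral_meas_lt_of_le_one {f : ℝ → ℝ≥0∞} (hf : Measurable f)
    (hf₁ : ∀ x, f x ≤ 1) :
    ∫⁻ x, f x = ∫⁻ t in Set.Ioo (0 : ℝ) 1, volume {x | ENNReal.ofReal t < f x} := by
  have hfin : ∀ x, f x ≠ ∞ := fun x => ((hf₁ x).trans_lt ENNReal.one_lt_top).ne
  have hset : ∀ t ∈ Set.Ioi (0 : ℝ),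
      volume {x | t < (f x).toReal} = volume {x | ENNReal.ofReal t < f x} := by
    intro t ht
    congr 1
    ext x
    exact (ENNReal.ofReal_lt_iff_lt_toReal (le_of_lt ht) (hfin x)).symm
  calc ∫⁻ x, f x = ∫⁻ x, ENNReal.ofReal (f x).toReal := by
        simp only [ENNReal.ofReal_toReal (hfin _)]
    _ = ∫⁻ t in Set.Ioi (0 : ℝ), volume {x | t < (f x).toReal} :=
        lintegral_eq_lintegral_meas_lt _ (ae_of_all _ fun _ => ENNReal.toReal_nonneg)
          hf.ennreal_toReal.aemeasurable
    _ = ∫⁻ t in Set.Ioi (0 : ℝ), volume {x | ENNReal.ofReal t < f x} :=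
        setLIntegral_congr_fun measurableSet_Ioi hset
    _ = ∫⁻ t in Set.Ioo (0 : ℝ) 1, volume {x | ENNReal.ofReal t < f x} := by
        rw [← Set.Ioo_union_Ici_eq_Ioi zero_lt_one, lintegral_union measurableSet_Ici
          (Set.disjoint_left.2 fun t ht ht' => not_lt.2 ht' ht.2)]
        have : ∫⁻ t in Set.Ici (1 : ℝ), volume {x | ENNReal.ofReal t < f x} = 0 := by
          rw [setLIntegral_congr_fun measurableSet_Ici (g := fun _ => 0), lintegral_zero]
          intro t ht
          have : {x | ENNReal.ofReal t < f x} = ∅ := by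
            ext x
            simp only [Set.mem_ofPred_eq, Set.mem_empty_iff_false, iff_false, not_lt]
            exact (hf₁ x).trans (ENNReal.one_le_ofReal.2 ht)
          simp [this]
        rw [this, add_zero]

theorem lintegral_add_lintegral_le_of_iSup_eq_one {f g h : ℝ → ℝ≥0∞} (hf : Measurable f)
    (hg : Measurable g) (hh : Measurable h) (hf₁ : (⨆ x, f x) = 1) (hg₁ : (⨆ x, g x) = 1)
    (hfgh : ∀ x y, f x * g y ≤ h (2⁻¹ * (x + y)) ^ 2) :
    (∫⁻ x, f x) + ∫⁻ x, g x ≤ 2 * ∫⁻ x, h x := by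
  have hh' : Measurable fun x => min (h x) 1 := hh.min measurable_const
  have hmeas : ∀ k : ℝ → ℝ≥0∞, Measurable fun t : ℝ => volume {x | ENNReal.ofReal t < k x} :=
    fun k => Antitone.measurable fun s t hst =>
      measure_mono fun x hx => (ENNReal.ofReal_le_ofReal hst).trans_lt hx
  calc (∫⁻ x, f x) + ∫⁻ x, g x
      = ∫⁻ t in Set.Ioo (0 : ℝ) 1, (volume {x | ENNReal.ofReal t < f x}
          + volume {x | ENNReal.ofReal t < g x}) := by
        rw [lintegral_add_left (hmeas f),
          lintegral_eq_setLIntegral_meas_lt_of_le_one hf fun x => hf₁ ▸ le_iSup f x,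
          lintegral_eq_setLIntegral_meas_lt_of_le_one hg fun x => hg₁ ▸ le_iSup g x]
    _ ≤ ∫⁻ t in Set.Ioo (0 : ℝ) 1, 2 * volume {x | ENNReal.ofReal t < min (h x) 1} := by
        refine setLIntegral_mono ((hmeas _).const_mul 2) fun t ht => ?_
        have ht₁ : ENNReal.ofReal t < 1 := ENNReal.ofReal_lt_one.2 ht.2
        obtain ⟨x₀, hx₀⟩ := lt_iSup_iff.1 (ht₁.trans_eq hf₁.symm)
        obtain ⟨y₀, hy₀⟩ := lt_iSup_iff.1 (ht₁.trans_eq hg₁.symm)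
        refine volume_add_volume_le_two_mul (measurableSet_lt measurable_const hf)
          (measurableSet_lt measurable_const hg) ⟨x₀, hx₀⟩ ⟨y₀, hy₀⟩
          fun x hx y hy => lt_min ?_ ht₁
        by_contra! hle
        refine absurd (hfgh x y) (not_le.2 ?_)
        calc h (2⁻¹ * (x + y)) ^ 2 ≤ ENNReal.ofReal t ^ 2 := by gcongr
          _ = ENNReal.ofReal t * ENNReal.ofReal t := sq _
          _ < f x * g y := ENNReal.mul_lt_mul hx hy
    _ = 2 * ∫⁻ x, min (h x) 1 := by
        rw [lintegral_const_mul _ (hmeas _),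
          lintegral_eq_setLIntegral_meas_lt_of_le_one hh' fun x => min_le_right _ _]
    _ ≤ 2 * ∫⁻ x, h x := by
        gcongr
        exact min_le_left _ _

theorem mul_le_sq_of_add_le_two_mul {a b c : ℝ≥0∞} (h : a + b ≤ 2 * c) : a * b ≤ c ^ 2 := by
  by_cases hc : c = ∞
  · simp [hc]
  have hab : a + b ≠ ∞ := ne_top_of_le_ne_top (ENNReal.mul_ne_top (by simp) hc) h
  lift c to NNReal using hc
  lift a to NNReal using (ENNReal.add_ne_top.1 hab).1
  lift b to NNReal using (ENNReal.add_ne_top.1 hab).2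
  norm_cast at h ⊢
  have h' : (a : ℝ) + b ≤ 2 * c := by exact_mod_cast h
  suffices (a : ℝ) * b ≤ c ^ 2 by exact_mod_cast this
  nlinarith [sq_nonneg ((a : ℝ) - b), a.2, b.2, c.2]

theorem lintegral_mul_lintegral_le_sq_of_iSup_ne_top {f g h : ℝ → ℝ≥0∞} (hf : Measurable f)
    (hg : Measurable g) (hh : Measurable h) (hf₁ : (⨆ x, f x) ≠ ∞) (hg₁ : (⨆ x, g x) ≠ ∞)
    (hfgh : ∀ x y, f x * g y ≤ h (2⁻¹ * (x + y)) ^ 2) :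
    (∫⁻ x, f x) * ∫⁻ x, g x ≤ (∫⁻ x, h x) ^ 2 := by
  set a := ⨆ x, f x with ha
  set b := ⨆ x, g x with hb
  by_cases ha₀ : a = 0
  · have : ∀ x, f x = 0 := ENNReal.iSup_eq_zero.1 ha₀
    simp [this]
  by_cases hb₀ : b = 0
  · have : ∀ x, g x = 0 := ENNReal.iSup_eq_zero.1 hb₀
    simp [this]
  set c := (a⁻¹ * b⁻¹) ^ (2⁻¹ : ℝ) with hc
  have hc₂ : c ^ 2 = a⁻¹ * b⁻¹ := by
    rw [hc, ← ENNReal.rpow_natCast, ← ENNReal.rpow_mul]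
    simp
  have key := mul_le_sq_of_add_le_two_mul (lintegral_add_lintegral_le_of_iSup_eq_one
    (hf.const_mul a⁻¹) (hg.const_mul b⁻¹) (hh.const_mul c)
    (by rw [← ENNReal.mul_iSup, ← ha, ENNReal.inv_mul_cancel ha₀ hf₁])
    (by rw [← ENNReal.mul_iSup, ← hb, ENNReal.inv_mul_cancel hb₀ hg₁])
    (fun x y => by
      rw [mul_pow, hc₂, mul_mul_mul_comm]
      gcongr
      exact hfgh x y))
  rw [lintegral_const_mul _ hf, lintegral_const_mul _ hg, lintegral_const_mul _ hh, mul_pow, hc₂,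
    mul_mul_mul_comm] at key
  refine (ENNReal.mul_le_mul_iff_right ?_ ?_).1 key
  · simp [hf₁, hg₁]
  · simp [ENNReal.mul_eq_top, ha₀, hb₀]

theorem lintegral_eq_iSup_lintegral_min_natCast {f : ℝ → ℝ≥0∞} (hf : Measurable f) :
    ∫⁻ x, f x = ⨆ k : ℕ, ∫⁻ x, min (f x) k := by
  rw [← lintegral_iSup (fun k => hf.min measurable_const)
    (fun k l hkl x => min_le_min_left _ (by exact_mod_cast hkl))]
  refine lintegral_congr fun x => ?_
  rw [← inf_iSup_eq, ENNReal.iSup_natCast, inf_top_eq]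

/-- The Prékopa–Leindler inequality for midpoints on the real line. -/
theorem lintegral_mul_lintegral_le_sq {f g h : ℝ → ℝ≥0∞} (hf : Measurable f)
    (hg : Measurable g) (hh : Measurable h)
    (hfgh : ∀ x y, f x * g y ≤ h (2⁻¹ * (x + y)) ^ 2) :
    (∫⁻ x, f x) * ∫⁻ x, g x ≤ (∫⁻ x, h x) ^ 2 := by
  rw [lintegral_eq_iSup_lintegral_min_natCast hf, lintegral_eq_iSup_lintegral_min_natCast hg,
    ENNReal.iSup_mul]
  refine iSup_le fun k => ?_
  rw [ENNReal.mul_iSup]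
  refine iSup_le fun l => ?_
  refine lintegral_mul_lintegral_le_sq_of_iSup_ne_top (hf.min measurable_const)
    (hg.min measurable_const) hh
    (ne_top_of_le_ne_top (ENNReal.natCast_ne_top k) (iSup_le fun x => min_le_right _ _))
    (ne_top_of_le_ne_top (ENNReal.natCast_ne_top l) (iSup_le fun x => min_le_right _ _))
    fun x y => (mul_le_mul' (min_le_left _ _) (min_le_left _ _)).trans (hfgh x y)

theorem gaussianPDFReal_mul_mul_exp (x y : ℝ) :
    gaussianPDFReal 0 1 x * gaussianPDFReal 0 1 y * Real.exp ((x - y) ^ 2 / 8) ^ 2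
      = gaussianPDFReal 0 1 (2⁻¹ * (x + y)) ^ 2 := by
  simp only [gaussianPDFReal, mul_pow, sub_zero, NNReal.coe_one, mul_one]
  rw [mul_mul_mul_comm, ← sq, mul_assoc]
  congr 1
  rw [← Real.exp_add, ← Real.exp_nat_mul, ← Real.exp_nat_mul, ← Real.exp_add]
  congr 1
  push_cast
  ring

/-- The Prékopa–Leindler inequality for midpoints and the standard Gaussian measure on `ℝ`. -/
theorem lintegral_gaussianReal_mul_le_sq {f g h : ℝ → ℝ≥0∞} (hf : Measurable f)
    (hg : Measurable g) (hh : Measurable h)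
    (hfgh : ∀ x y, f x * g y
      ≤ (ENNReal.ofReal (Real.exp ((x - y) ^ 2 / 8)) * h (2⁻¹ * (x + y))) ^ 2) :
    (∫⁻ x, f x ∂gaussianReal 0 1) * ∫⁻ x, g x ∂gaussianReal 0 1
      ≤ (∫⁻ x, h x ∂gaussianReal 0 1) ^ 2 := by
  have hφ : Measurable (gaussianPDF 0 1) := measurable_gaussianPDF 0 1
  simp only [gaussianReal_of_var_ne_zero 0 one_ne_zero,
    lintegral_withDensity_eq_lintegral_mul _ hφ hf,
    lintegral_withDensity_eq_lintegral_mul _ hφ hg,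
    lintegral_withDensity_eq_lintegral_mul _ hφ hh]
  refine lintegral_mul_lintegral_le_sq (hφ.mul hf) (hφ.mul hg) (hφ.mul hh) fun x y => ?_
  have hpdf : gaussianPDF 0 1 x * gaussianPDF 0 1 y
      * ENNReal.ofReal (Real.exp ((x - y) ^ 2 / 8)) ^ 2
      = gaussianPDF 0 1 (2⁻¹ * (x + y)) ^ 2 := by
    simp only [gaussianPDF]
    rw [← ENNReal.ofReal_mul (gaussianPDFReal_nonneg _ _ _), ← ENNReal.ofReal_pow (by positivity),
      ← ENNReal.ofReal_mul (mul_nonneg (gaussianPDFReal_nonneg _ _ _)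
        (gaussianPDFReal_nonneg _ _ _)),
      ← ENNReal.ofReal_pow (gaussianPDFReal_nonneg _ _ _), gaussianPDFReal_mul_mul_exp]
  simp only [Pi.mul_apply]
  rw [mul_mul_mul_comm, mul_pow, ← hpdf, mul_assoc _ (_ ^ 2), ← mul_pow]
  gcongr
  exact hfgh x y

instance (n : ℕ) : IsProbabilityMeasure (stdGaussian n) := by
  unfold _root_.stdGaussian
  infer_instance

theorem lintegral_stdGaussian_succ {n : ℕ} {f : (Fin (n + 1) → ℝ) → ℝ≥0∞} (hf : Measurable f) :
    ∫⁻ x, f x ∂stdGaussian (n + 1)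
      = ∫⁻ a, ∫⁻ x, f (Fin.cons a x) ∂stdGaussian n ∂gaussianReal 0 1 := by
  have hmp := (measurePreserving_piFinSuccAbove
    (fun _ : Fin (n + 1) => gaussianReal 0 1) 0).symm
  rw [_root_.stdGaussian, ← hmp.lintegral_comp hf]
  refine (lintegral_prod _ (hf.comp (MeasurableEquiv.measurable _)).aemeasurable).trans ?_
  simp only [MeasurableEquiv.piFinSuccAbove_symm_apply, Fin.insertNthEquiv_zero]
  rfl

theorem measurable_finCons {n : ℕ} :
    Measurable fun p : ℝ × (Fin n → ℝ) => (Fin.cons p.1 p.2 : Fin (n + 1) → ℝ) := by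
  refine measurable_pi_iff.2 fun i => Fin.cases ?_ (fun j => ?_) i
  · exact measurable_fst
  · exact (measurable_pi_apply j).comp measurable_snd

/-- The Prékopa–Leindler inequality for midpoints and the standard Gaussian measure on `ℝⁿ`. -/
theorem lintegral_stdGaussian_mul_le_sq {n : ℕ} {f g h : (Fin n → ℝ) → ℝ≥0∞} (hf : Measurable f)
    (hg : Measurable g) (hh : Measurable h)
    (hfgh : ∀ x y, f x * g y
      ≤ (ENNReal.ofReal (Real.exp (∑ i, (x i - y i) ^ 2 / 8)) * h ((2⁻¹ : ℝ) • (x + y))) ^ 2) :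
    (∫⁻ x, f x ∂stdGaussian n) * ∫⁻ x, g x ∂stdGaussian n ≤ (∫⁻ x, h x ∂stdGaussian n) ^ 2 := by
  induction n with
  | zero =>
    have hdirac : stdGaussian 0 = Measure.dirac 0 := Measure.pi_of_empty _ _
    simpa [hdirac] using hfgh 0 0
  | succ n ih =>
    have hcons : ∀ {k : (Fin (n + 1) → ℝ) → ℝ≥0∞}, Measurable k → ∀ a : ℝ,
        Measurable fun x : Fin n → ℝ => k (Fin.cons a x) := fun hk a =>
      hk.comp (measurable_finCons.comp measurable_prodMk_left)
    have hint : ∀ {k : (Fin (n + 1) → ℝ) → ℝ≥0∞}, Measurable k →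
        Measurable fun a : ℝ => ∫⁻ x, k (Fin.cons a x) ∂stdGaussian n := fun hk =>
      (hk.comp measurable_finCons).lintegral_prod_right'
    rw [lintegral_stdGaussian_succ hf, lintegral_stdGaussian_succ hg,
      lintegral_stdGaussian_succ hh]
    refine lintegral_gaussianReal_mul_le_sq (hint hf) (hint hg) (hint hh) fun a b => ?_
    rw [← lintegral_const_mul _ (hcons hh _)]
    refine ih (hcons hf a) (hcons hg b) ((hcons hh _).const_mul _) fun x y => ?_
    refine (hfgh (Fin.cons a x) (Fin.cons b y)).trans_eq ?_
    have hmid : (2⁻¹ : ℝ) • ((Fin.cons a x : Fin (n + 1) → ℝ) + Fin.cons b y)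
        = Fin.cons (2⁻¹ * (a + b)) ((2⁻¹ : ℝ) • (x + y)) := by
      ext i
      refine Fin.cases ?_ (fun j => ?_) i <;> simp [mul_add]
    rw [hmid, Fin.sum_univ_succ, ← mul_assoc, ← ENNReal.ofReal_mul (by positivity),
      ← Real.exp_add, add_comm]
    simp

theorem stdGaussian_absolutelyContinuous (n : ℕ) : stdGaussian n ≪ volume := by
  induction n with
  | zero =>
    have h₁ : stdGaussian 0 = Measure.dirac 0 := Measure.pi_of_empty _ _
    have h₂ : (volume : Measure (Fin 0 → ℝ)) = Measure.dirac 0 := Measure.pi_of_empty _ _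
    rw [h₁, h₂]
  | succ n ih =>
    have h₁ := (measurePreserving_piFinSuccAbove
      (fun _ : Fin (n + 1) => gaussianReal 0 1) 0).symm
    have h₂ := (volume_preserving_piFinSuccAbove (fun _ : Fin (n + 1) => ℝ) 0).symm
    rw [_root_.stdGaussian, ← h₁.map_eq, ← h₂.map_eq]
    exact ((gaussianReal_absolutelyContinuous 0 one_ne_zero).prod ih).map
      (MeasurableEquiv.measurable _)

theorem measurePreserving_neg_stdGaussian (n : ℕ) :
    MeasurePreserving (fun x : Fin n → ℝ => -x) (stdGaussian n) (stdGaussian n) :=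
  measurePreserving_pi _ _ fun _ =>
    ⟨measurable_neg, gaussianReal_map_neg.trans (by rw [neg_zero])⟩

theorem setLIntegral_exp_inner_le {n : ℕ} {K : Set (Fin n → ℝ)} (hconv : Convex ℝ K)
    (hsym : ∀ x ∈ K, -x ∈ K) (hK : MeasurableSet K) {v : Fin n → ℝ} (hv : ∑ i, v i ^ 2 = 1)
    (t : ℝ) :
    ∫⁻ x in K, ENNReal.ofReal (Real.exp (t * ∑ i, x i * v i)) ∂stdGaussian n
      ≤ ENNReal.ofReal (Real.exp (t ^ 2 / 2)) * stdGaussian n K := by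
  set e : ℝ → (Fin n → ℝ) → ℝ≥0∞ :=
    fun s => K.indicator fun x => ENNReal.ofReal (Real.exp (s * ∑ i, x i * v i)) with he
  have hmeas : ∀ s, Measurable (e s) := fun s => Measurable.indicator (by fun_prop) hK
  have hneg : ∫⁻ x, e (-t) x ∂stdGaussian n = ∫⁻ x, e t x ∂stdGaussian n := by
    rw [← (measurePreserving_neg_stdGaussian n).lintegral_comp (hmeas t)]
    refine lintegral_congr fun x => ?_
    by_cases hx : x ∈ K
    · simp [he, hx, hsym x hx]
    · have hx' : -x ∉ K := fun h => hx (by simpa using hsym _ h)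
      simp [he, hx, hx']
  have key := lintegral_stdGaussian_mul_le_sq (hmeas t) (hmeas (-t))
    (h := K.indicator fun _ => ENNReal.ofReal (Real.exp (t ^ 2 / 2)))
    (measurable_const.indicator hK) fun x y => by
      by_cases hx : x ∈ K
      swap; · simp [he, hx]
      by_cases hy : y ∈ K
      swap; · simp [he, hy]
      have hxy : (2⁻¹ : ℝ) • (x + y) ∈ K := by
        rw [smul_add]
        exact hconv hx hy (by norm_num) (by norm_num) (by norm_num)
      simp only [he, Set.indicator_of_mem hx, Set.indicator_of_mem hy, Set.indicator_of_mem hxy]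
      rw [← ENNReal.ofReal_mul (by positivity), ← ENNReal.ofReal_mul (by positivity),
        ← ENNReal.ofReal_pow (by positivity), ← Real.exp_add, ← Real.exp_add, ← Real.exp_nat_mul]
      refine ENNReal.ofReal_le_ofReal (Real.exp_le_exp.2 ?_)
      have hsq : 0 ≤ ∑ i, ((x i - y i) / 2 - t * v i) ^ 2 :=
        Finset.sum_nonneg fun i _ => sq_nonneg _
      have hexpand : ∑ i, ((x i - y i) / 2 - t * v i) ^ 2
          = 2 * (∑ i, (x i - y i) ^ 2 / 8) - t * ∑ i, x i * v i + t * ∑ i, y i * v i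
            + t ^ 2 * ∑ i, v i ^ 2 := by
        simp only [Finset.mul_sum, ← Finset.sum_sub_distrib, ← Finset.sum_add_distrib]
        exact Finset.sum_congr rfl fun i _ => by ring
      rw [hexpand, hv] at hsq
      push_cast
      linarith
  rw [hneg, ← sq, lintegral_indicator_const hK] at key
  rw [← lintegral_indicator hK]
  exact (ENNReal.pow_le_pow_left_iff two_ne_zero).1 key

theorem two_add_sq_le_exp_add_exp_neg (x : ℝ) : 2 + x ^ 2 ≤ Real.exp x + Real.exp (-x) := by
  have hsinh : (x / 2) ^ 2 ≤ Real.sinh (x / 2) ^ 2 := by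
    rw [sq_le_sq, Real.abs_sinh]
    exact Real.self_le_sinh_iff.2 (abs_nonneg _)
  have hcosh : Real.cosh x = 1 + 2 * Real.sinh (x / 2) ^ 2 := by
    have h₁ := Real.cosh_two_mul (x / 2)
    have h₂ := Real.cosh_sq (x / 2)
    rw [mul_div_cancel₀ x two_ne_zero] at h₁
    linarith
  rw [Real.cosh_eq] at hcosh
  linarith

theorem setLIntegral_two_add_sq_le {n : ℕ} {K : Set (Fin n → ℝ)} (hconv : Convex ℝ K)
    (hsym : ∀ x ∈ K, -x ∈ K) (hK : MeasurableSet K) {v : Fin n → ℝ} (hv : ∑ i, v i ^ 2 = 1)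
    (t : ℝ) :
    ∫⁻ x in K, ENNReal.ofReal (2 + (t * ∑ i, x i * v i) ^ 2) ∂stdGaussian n
      ≤ ENNReal.ofReal (2 * Real.exp (t ^ 2 / 2)) * stdGaussian n K := by
  calc ∫⁻ x in K, ENNReal.ofReal (2 + (t * ∑ i, x i * v i) ^ 2) ∂stdGaussian n
      ≤ ∫⁻ x in K, (ENNReal.ofReal (Real.exp (t * ∑ i, x i * v i))
          + ENNReal.ofReal (Real.exp (-t * ∑ i, x i * v i))) ∂stdGaussian n := by
        refine lintegral_mono fun x => ?_
        rw [← ENNReal.ofReal_add (by positivity) (by positivity), neg_mul]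
        exact ENNReal.ofReal_le_ofReal (two_add_sq_le_exp_add_exp_neg _)
    _ = (∫⁻ x in K, ENNReal.ofReal (Real.exp (t * ∑ i, x i * v i)) ∂stdGaussian n)
          + ∫⁻ x in K, ENNReal.ofReal (Real.exp (-t * ∑ i, x i * v i)) ∂stdGaussian n :=
        lintegral_add_left (by fun_prop) _
    _ ≤ ENNReal.ofReal (Real.exp (t ^ 2 / 2)) * stdGaussian n K
          + ENNReal.ofReal (Real.exp ((-t) ^ 2 / 2)) * stdGaussian n K :=
        add_le_add (setLIntegral_exp_inner_le hconv hsym hK hv t)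
          (setLIntegral_exp_inner_le hconv hsym hK hv (-t))
    _ = ENNReal.ofReal (2 * Real.exp (t ^ 2 / 2)) * stdGaussian n K := by
        rw [neg_sq, ← add_mul, ← ENNReal.ofReal_add (by positivity) (by positivity), two_mul]

theorem setIntegral_sq_sub_one_nonpos {n : ℕ} {K : Set (Fin n → ℝ)} (hconv : Convex ℝ K)
    (hsym : ∀ x ∈ K, -x ∈ K) (hK : MeasurableSet K) {v : Fin n → ℝ} (hv : ∑ i, v i ^ 2 = 1) :
    ∫ x in K, ((∑ i, x i * v i) ^ 2 - 1) ∂stdGaussian n ≤ 0 := by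
  have hfin : ∀ t : ℝ, ENNReal.ofReal (2 * Real.exp (t ^ 2 / 2)) * stdGaussian n K ≠ ∞ :=
    fun t => ENNReal.mul_ne_top ENNReal.ofReal_ne_top (measure_ne_top _ _)
  have hint : Integrable (fun x : Fin n → ℝ => (∑ i, x i * v i) ^ 2)
      ((stdGaussian n).restrict K) := by
    refine ⟨Measurable.aestronglyMeasurable (by fun_prop), ?_⟩
    rw [hasFiniteIntegral_iff_ofReal (ae_of_all _ fun x => sq_nonneg _)]
    refine lt_of_le_of_lt ((lintegral_mono fun x => ?_).trans
      (setLIntegral_two_add_sq_le hconv hsym hK hv 1)) (hfin 1).lt_top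
    exact ENNReal.ofReal_le_ofReal (by rw [one_mul]; linarith)
  set S := ∫ x in K, (∑ i, x i * v i) ^ 2 ∂stdGaussian n with hS
  set m := (stdGaussian n).real K with hm
  have hbound : ∀ t : ℝ, 2 * m + t ^ 2 * S ≤ 2 * Real.exp (t ^ 2 / 2) * m := by
    intro t
    have h := setLIntegral_two_add_sq_le hconv hsym hK hv t
    simp only [mul_pow] at h
    have hint' : Integrable (fun x : Fin n → ℝ => 2 + t ^ 2 * (∑ i, x i * v i) ^ 2)
        ((stdGaussian n).restrict K) := (integrable_const _).add (hint.const_mul _)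
    rw [← ofReal_integral_eq_lintegral_ofReal hint' (ae_of_all _ fun x => by positivity),
      ← ofReal_measureReal, ← ENNReal.ofReal_mul (by positivity),
      ENNReal.ofReal_le_ofReal_iff (by positivity),
      integral_add (integrable_const _) (hint.const_mul _), integral_const_mul] at h
    simpa [mul_comm, hm, hS] using h
  have hm₀ : 0 ≤ m := measureReal_nonneg
  have hSm : S ≤ m := by
    refine le_of_forall_pos_le_add fun ε hε => ?_
    set y := min 1 (ε / (m + 1)) with hy
    have hy₀ : 0 < y := lt_min one_pos (by positivity)
    have hy₁ : y ≤ 1 := min_le_left _ _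
    have hyε : y * (m + 1) ≤ ε := (le_div_iff₀ (by positivity)).1 (min_le_right _ _)
    have hb := hbound (Real.sqrt (2 * y))
    rw [Real.sq_sqrt (by positivity), mul_div_cancel_left₀ _ two_ne_zero] at hb
    have hexp := (abs_le.1 (Real.abs_exp_sub_one_sub_id_le
      (abs_le.2 ⟨by linarith, hy₁⟩))).2
    have hmul : y * S ≤ y * (m + y * m) := by nlinarith
    have := le_of_mul_le_mul_left hmul hy₀
    nlinarith
  rw [integral_sub hint (integrable_const _)]
  simpa [hS, hm] using hSm

/-- Nonnegativity of directional influences of centrally symmetric convex sets: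
`Inf_v[K] = E_{x ~ N(0,1)^n}[-K(x)·(⟨x,v⟩² - 1)/√2] ≥ 0` for unit `v`. -/
theorem stmt10 (n : ℕ) (K : Set (Fin n → ℝ)) (hconv : Convex ℝ K)
    (hsym : ∀ x ∈ K, -x ∈ K) (v : Fin n → ℝ) (hv : ∑ i, (v i) ^ 2 = 1) :
    0 ≤ ∫ x, (-(K.indicator (fun _ => (1:ℝ)) x)) *
          (((∑ i, x i * v i) ^ 2 - 1) / Real.sqrt 2) ∂(stdGaussian n) := by
  have hfr : ∀ᵐ x ∂stdGaussian n, x ∉ frontier K :=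
    measure_eq_zero_iff_ae_notMem.1
      (stdGaussian_absolutelyContinuous n (hconv.addHaar_frontier volume))
  have hsym' : ∀ x ∈ closure K, -x ∈ closure K := fun x hx =>
    map_mem_closure continuous_neg hx hsym
  have hcongr : ∫ x, (-(K.indicator (fun _ => (1:ℝ)) x)) *
        (((∑ i, x i * v i) ^ 2 - 1) / Real.sqrt 2) ∂(stdGaussian n)
      = ∫ x, -(Real.sqrt 2)⁻¹ *
        (closure K).indicator (fun x => (∑ i, x i * v i) ^ 2 - 1) x ∂(stdGaussian n) := by
    refine integral_congr_ae ?_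
    filter_upwards [hfr] with x hx
    by_cases hxK : x ∈ K
    · simp only [Set.indicator_of_mem hxK, Set.indicator_of_mem (subset_closure hxK)]
      ring
    · have hxc : x ∉ closure K := fun h => hx ⟨h, fun hi => hxK (interior_subset hi)⟩
      simp [hxK, hxc]
  rw [hcongr, integral_const_mul, integral_indicator isClosed_closure.measurableSet]
  exact mul_nonneg_of_nonpos_of_nonpos (by simp)
    (setIntegral_sq_sub_one_nonpos hconv.closure hsym' isClosed_closure.measurableSet hv)
end

section
/- Let \Omega = \{0,\dots,m-1\} with full-support measure \pi, and let f, g : \Omega^n \to \R be monotone with E[f^2] \le 1 and E[g^2] \le 1 (expectations w.r.t. \pi^{\otimes n}). Then E[fg] - E[f]E[g] \ge (1/C) \cdot \Phi(\sum_{i=1}^n E[f^{=\{i\}} g^{=\{i\}}]), where f^{=\{i\}}(x) = E_{y \sim \pi^{\otimes n}}[f(y_1,\dots,y_{i-1}, x_i, y_{i+1},\dots,y_n)] - E[f], \Phi(x) = \min\{x, x/\log^2(1/x)\}, and C > 0 is a universal constant. -/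
/-- `Φ(x) = min{x, x / log²(1/x)}`. -/
noncomputable def Phi (x : ℝ) : ℝ := min x (x / (Real.log (1 / x)) ^ 2)

open Finset Polynomial in
/-- Endpoint case of the Markov inequality for derivatives of polynomials, on the interval `[0, 1/8]`. -/
theorem derivative_eval_zero_le_of_abs_le {P : ℝ[X]} {d : ℕ} (hd : P.natDegree ≤ d) {B : ℝ}
    (hB : 0 < B) (hP : ∀ t ∈ Set.Icc (0 : ℝ) (1 / 8), |P.eval t| ≤ B) :
    (derivative P).eval 0 ≤ 16 * d ^ 2 * B := by
  set L : ℝ[X] := C (1 / 16) * (1 - X) with hL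
  set R : ℝ[X] := C (-B⁻¹) * P.comp L with hR
  have hLdeg : L.natDegree ≤ 1 := by rw [hL]; compute_degree
  have hRdeg : R.degree ≤ d := by
    refine natDegree_le_iff_degree_le.mp ?_
    refine (natDegree_C_mul_le _ _).trans (natDegree_comp_le.trans ?_)
    calc P.natDegree * L.natDegree ≤ d * 1 := Nat.mul_le_mul hd hLdeg
      _ = d := mul_one d
  have hRb : ∀ x ∈ Set.Icc (-1 : ℝ) 1, |R.eval x| ≤ 1 := by
    intro x hx
    have := hP (1 / 16 * (1 - x)) ⟨by linarith [hx.2], by linarith [hx.1]⟩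
    simp only [hR, hL, eval_mul, eval_C, eval_comp, eval_sub, eval_one, eval_X, abs_mul, abs_neg,
      abs_inv, abs_of_pos hB]
    rw [inv_mul_le_iff₀ hB, mul_one]
    exact this
  have key := Chebyshev.eval_iterate_derivative_le_of_forall_abs_le_one (k := 1) le_rfl hRdeg hRb
  have hT : (derivative (Chebyshev.T ℝ d)).eval 1 = (d : ℝ) ^ 2 := by
    rw [Chebyshev.T_derivative_eq_U]
    simp
    ring
  simp only [Function.iterate_one, hT] at key
  have hder : (derivative R).eval 1 = B⁻¹ * (1 / 16) * (derivative P).eval 0 := by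
    simp [hR, hL, derivative_comp]
    ring
  rw [hder] at key
  have := mul_le_mul_of_nonneg_left key (by positivity : (0 : ℝ) ≤ 16 * B)
  have h2 : 16 * B * (B⁻¹ * (1 / 16) * (derivative P).eval 0) = (derivative P).eval 0 := by
    field_simp
  linarith

open Finset Polynomial in
/-- If a polynomial with coefficients of total mass at most one deviates by at most `M` from a
constant on `[0, 1/8]`, then its linear coefficient is bounded by `M`, up to truncation. -/
theorem linear_coeff_le_of_abs_sub_le {κ : Type*} [Fintype κ] (c : κ → ℝ) (k : κ → ℕ) (b M : ℝ)
    (hc : ∑ j, |c j| ≤ 1)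
    (hM : ∀ t ∈ Set.Icc (0 : ℝ) (1 / 8), |∑ j, c j * t ^ k j - b| ≤ M) {d : ℕ} (hd : 1 ≤ d) :
    ∑ j with k j = 1, c j ≤ 16 * d ^ 2 * (M + (1 / 8) ^ d) := by
  set P : ℝ[X] := (∑ j with k j ≤ d, C (c j) * X ^ k j) - C b with hPdef
  have hM0 : 0 ≤ M := (abs_nonneg _).trans (hM 0 ⟨le_rfl, by norm_num⟩)
  have hdeg : P.natDegree ≤ d := by
    rw [hPdef, natDegree_sub_C]
    refine natDegree_sum_le_of_forall_le _ _ fun j hj => ?_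
    exact (natDegree_C_mul_X_pow_le _ _).trans (mem_filter.mp hj).2
  have hder : (derivative P).eval 0 = ∑ j with k j = 1, c j := by
    rw [← coeff_zero_eq_eval_zero, coeff_derivative, hPdef]
    simp only [coeff_sub, finsetSum_coeff, coeff_C_mul, coeff_X_pow, coeff_C]
    simp only [zero_add, mul_ite, mul_one, mul_zero, one_ne_zero, if_false, sub_zero,
      Nat.cast_zero]
    rw [← sum_filter, filter_filter]
    refine sum_congr (filter_congr fun j _ => ?_) fun _ _ => rfl
    omega
  rw [← hder]
  refine derivative_eval_zero_le_of_abs_le hdeg (by positivity) fun t ht => ?_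
  have hev : P.eval t = (∑ j, c j * t ^ k j - b) - ∑ j with ¬ k j ≤ d, c j * t ^ k j := by
    rw [← sum_filter_add_sum_filter_not univ (fun j => k j ≤ d) (fun j => c j * t ^ k j)]
    simp [hPdef, eval_finsetSum]
    ring
  have htail : |∑ j with ¬ k j ≤ d, c j * t ^ k j| ≤ (1 / 8) ^ d := by
    calc |∑ j with ¬ k j ≤ d, c j * t ^ k j|
        ≤ ∑ j with ¬ k j ≤ d, |c j * t ^ k j| := abs_sum_le_sum_abs _ _
      _ ≤ ∑ j with ¬ k j ≤ d, |c j| * (1 / 8) ^ d := by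
          refine sum_le_sum fun j hj => ?_
          have hj' : d ≤ k j := by have := (mem_filter.mp hj).2; omega
          rw [abs_mul, abs_of_nonneg (pow_nonneg ht.1 _)]
          refine mul_le_mul_of_nonneg_left ?_ (abs_nonneg _)
          exact (pow_le_pow_left₀ ht.1 ht.2 _).trans
            (pow_le_pow_of_le_one (by norm_num) (by norm_num) hj')
      _ ≤ ∑ j, |c j| * (1 / 8) ^ d :=
          sum_le_sum_of_subset_of_nonneg (subset_univ _) fun _ _ _ => by positivity
      _ ≤ (1 / 8) ^ d := by
          rw [← sum_mul]
          exact mul_le_of_le_one_left (by positivity) hc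
  rw [hev]
  exact (abs_sub _ _).trans (add_le_add (hM t ht) htail)

open Finset in
theorem Phi_linear_coeff_le {κ : Type*} [Fintype κ] (c : κ → ℝ) (k : κ → ℕ) (b M : ℝ)
    (hc : ∑ j, |c j| ≤ 1)
    (hM : ∀ t ∈ Set.Icc (0 : ℝ) (1 / 8), |∑ j, c j * t ^ k j - b| ≤ M) :
    Phi (∑ j with k j = 1, c j) ≤ 2048 * M := by
  have hM0 : 0 ≤ M := (abs_nonneg _).trans (hM 0 ⟨le_rfl, by norm_num⟩)
  have hlin := fun d (hd : 1 ≤ d) => linear_coeff_le_of_abs_sub_le c k b M hc hM (d := d) hd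
  have hx1 : ∑ j with k j = 1, c j ≤ 1 :=
    calc ∑ j with k j = 1, c j ≤ ∑ j with k j = 1, |c j| := sum_le_sum fun j _ => le_abs_self _
      _ ≤ ∑ j, |c j| :=
        sum_le_sum_of_subset_of_nonneg (subset_univ _) fun _ _ _ => abs_nonneg _
      _ ≤ 1 := hc
  generalize (∑ j with k j = 1, c j) = x at hlin hx1
  unfold Phi
  rcases le_or_gt x 0 with hx0 | hx0
  · exact (min_le_left _ _).trans (by linarith)
  set L := Real.log (1 / x) with hL
  have hL0 : 0 ≤ L := Real.log_nonneg (by rw [le_div_iff₀ hx0]; linarith)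
  have hexp : Real.exp (-L) = x := by
    rw [hL, one_div, Real.log_inv, neg_neg, Real.exp_log hx0]
  set d := ⌈2 * L⌉₊ + 5 with hd
  have hdle : (d : ℝ) ≤ 2 * L + 6 := by
    have := (Nat.ceil_lt_add_one (by positivity : 0 ≤ 2 * L)).le
    rw [hd]; push_cast; linarith
  have hhalf : ((1 : ℝ) / 2) ^ d ≤ x / 32 := by
    have hle : 2 * L ≤ (⌈2 * L⌉₊ : ℝ) := Nat.le_ceil _
    have h1 : ((1 : ℝ) / 2) ^ ⌈2 * L⌉₊ ≤ x := by
      rw [← Real.exp_log (by norm_num : (0 : ℝ) < 1 / 2), ← Real.exp_nat_mul, ← hexp,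
        Real.exp_le_exp, one_div, Real.log_inv]
      nlinarith [Real.log_two_gt_d9]
    rw [hd, pow_add]
    linarith
  have hsq : (d : ℝ) ^ 2 * (1 / 8) ^ d ≤ (1 / 2) ^ d := by
    have h2 : (d : ℝ) ≤ 2 ^ d := by exact_mod_cast Nat.lt_two_pow_self.le
    calc (d : ℝ) ^ 2 * (1 / 8) ^ d ≤ (2 ^ d) ^ 2 * (1 / 8) ^ d := by gcongr
      _ = (1 / 2) ^ d := by rw [← pow_mul, mul_comm d 2, pow_mul, ← mul_pow]; norm_num
  have hmain : x ≤ 32 * d ^ 2 * M := by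
    have := hlin d (by omega)
    linarith
  have hbound : x ≤ 32 * (2 * L + 6) ^ 2 * M := hmain.trans (by gcongr)
  rcases le_total L 1 with hL1 | hL1
  · refine (min_le_left _ _).trans (hbound.trans ?_)
    refine mul_le_mul_of_nonneg_right ?_ hM0
    nlinarith
  · refine (min_le_right _ _).trans ?_
    rw [div_le_iff₀ (by positivity)]
    calc x ≤ 32 * (2 * L + 6) ^ 2 * M := hbound
      _ ≤ (2048 * L ^ 2) * M := mul_le_mul_of_nonneg_right (by nlinarith) hM0
      _ = 2048 * M * L ^ 2 := by ring

namespace ProductWeight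

open Finset

variable {ι α : Type*} [Fintype ι] [DecidableEq ι] [Fintype α] (w : α → ℝ)

/-- Expectation of `f` under the product weight `w^{⊗ι}`. -/
noncomputable def expect (f : (ι → α) → ℝ) : ℝ := ∑ x, (∏ i, w (x i)) * f x

/-- Averaging over the coordinates outside `S`. -/
noncomputable def avg (S : Finset ι) (f : (ι → α) → ℝ) (x : ι → α) : ℝ :=
  expect w fun y => f (S.piecewise x y)

/-- The correlation of `f` with the average of `g` outside `S`. -/
noncomputable def corr (f g : (ι → α) → ℝ) (S : Finset ι) : ℝ :=
  expect w fun x => f x * avg w S g x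

/-- The Möbius transform of `corr w f g`: the inner product of the Efron–Stein components of
`f` and `g` at `T`. -/
noncomputable def level (f g : (ι → α) → ℝ) (T : Finset ι) : ℝ :=
  ∑ S ∈ T.powerset, (-1) ^ (#T + #S) * corr w f g S

variable {w}

theorem expect_add (f g : (ι → α) → ℝ) :
    expect w (fun x => f x + g x) = expect w f + expect w g := by
  simp [expect, mul_add, sum_add_distrib]

theorem expect_const_mul (c : ℝ) (f : (ι → α) → ℝ) :
    expect w (fun x => c * f x) = c * expect w f := by
  simp only [expect, mul_sum]
  exact sum_congr rfl fun x _ => by ring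

theorem expect_sum {κ : Type*} (s : Finset κ) (F : κ → (ι → α) → ℝ) :
    expect w (fun x => ∑ k ∈ s, F k x) = ∑ k ∈ s, expect w (F k) := by
  simp only [expect, mul_sum]
  exact sum_comm

theorem expect_const (hw : ∑ a, w a = 1) (c : ℝ) : expect w (fun _ : ι → α => c) = c := by
  have h : ∑ x : ι → α, ∏ i, w (x i) = 1 := by
    rw [← Fintype.prod_sum fun (_ : ι) a => w a]
    simp [hw]
  rw [expect, ← sum_mul, h, one_mul]

theorem expect_mono (hw : ∀ a, 0 ≤ w a) {f g : (ι → α) → ℝ} (h : ∀ x, f x ≤ g x) :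
    expect w f ≤ expect w g :=
  sum_le_sum fun x _ => mul_le_mul_of_nonneg_left (h x) (prod_nonneg fun _ _ => hw _)

/-- Exchanging the coordinates outside `S` of two independent copies preserves expectations. -/
theorem expect_expect_exchange (S : Finset ι) (F : (ι → α) → (ι → α) → ℝ) :
    expect w (fun x => expect w fun y => F (S.piecewise x y) (S.piecewise y x)) =
      expect w fun x => expect w fun y => F x y := by
  have hinv : Function.Involutive
      fun p : (ι → α) × (ι → α) => (S.piecewise p.1 p.2, S.piecewise p.2 p.1) := by
    rintro ⟨x, y⟩
    ext i <;> by_cases hi : i ∈ S <;> simp [hi]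
  simp only [expect, mul_sum]
  rw [← Fintype.sum_prod_type', ← Fintype.sum_prod_type']
  refine Fintype.sum_bijective _ hinv.bijective _ _ ?_
  rintro ⟨x, y⟩
  simp only [← mul_assoc, ← prod_mul_distrib]
  congr 1
  refine prod_congr rfl fun i _ => ?_
  by_cases hi : i ∈ S <;> simp [hi, mul_comm]

theorem expect_avg (hw : ∑ a, w a = 1) (S : Finset ι) (f : (ι → α) → ℝ) :
    expect w (avg w S f) = expect w f := by
  unfold avg
  rw [expect_expect_exchange S fun x _ => f x]
  simp only [expect_const hw]

theorem corr_eq_left (S : Finset ι) (f g : (ι → α) → ℝ) :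
    corr w f g S = expect w fun x => avg w S f x * g x := by
  have h := expect_expect_exchange (w := w) S fun x y => f x * g (S.piecewise x y)
  have hpw : ∀ x y : ι → α, S.piecewise (S.piecewise x y) (S.piecewise y x) = x := by
    intro x y
    ext i
    by_cases hi : i ∈ S <;> simp [hi]
  simp only [hpw] at h
  simp only [corr, avg, ← expect_const_mul]
  rw [← h]
  congr 1
  ext x
  rw [mul_comm, ← expect_const_mul]
  simp only [mul_comm]

theorem avg_avg (hw : ∑ a, w a = 1) (S T : Finset ι) (f : (ι → α) → ℝ) :
    avg w S (avg w T f) = avg w (S ∩ T) f := by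
  ext x
  have h := expect_avg hw T fun u => f ((S ∩ T).piecewise x u)
  have hpw : ∀ y z : ι → α, (S ∩ T).piecewise x (T.piecewise y z) =
      T.piecewise (S.piecewise x y) z := by
    intro y z
    ext i
    by_cases hi : i ∈ S <;> by_cases hj : i ∈ T <;> simp [hi, hj]
  unfold avg at h ⊢
  simp only [hpw] at h
  exact h

theorem expect_avg_mul_avg (hw : ∑ a, w a = 1) (S T : Finset ι) (f g : (ι → α) → ℝ) :
    expect w (fun x => avg w S f x * avg w T g x) = corr w f g (S ∩ T) := by
  rw [← corr_eq_left, corr, avg_avg hw, corr]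

theorem corr_empty (f g : (ι → α) → ℝ) : corr w f g ∅ = expect w f * expect w g := by
  have : ∀ x, avg w ∅ g x = expect w g := fun x => by simp [avg]
  simp only [corr, this]
  rw [mul_comm, ← expect_const_mul]
  simp only [mul_comm]

theorem corr_univ (hw : ∑ a, w a = 1) (f g : (ι → α) → ℝ) :
    corr w f g univ = expect w fun x => f x * g x := by
  simp [corr, avg, expect_const hw]

/-- The second moment of the Efron–Stein component of `f` at `T` is `level w f f T`. -/
theorem expect_sq_eq_level (hw : ∑ a, w a = 1) (f : (ι → α) → ℝ) (T : Finset ι) :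
    expect w (fun x => (∑ S ∈ T.powerset, (-1) ^ (#T + #S) * avg w S f x) ^ 2) =
      level w f f T := by
  have hvanish : ∀ S ∈ T.powerset, S ≠ T →
      ∑ S' ∈ T.powerset, (-1 : ℝ) ^ (#T + #S') * corr w f f (S ∩ S') = 0 := by
    intro S hS hST
    obtain ⟨i, hiT, hiS⟩ := exists_of_ssubset ((mem_powerset.mp hS).ssubset_of_ne hST)
    rw [← insert_erase hiT, sum_powerset_insert (notMem_erase i T), ← sum_add_distrib]
    refine sum_eq_zero fun S' hS' => ?_
    have hi : i ∉ S' := fun h => notMem_erase i T (mem_powerset.mp hS' h)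
    rw [card_insert_of_notMem hi, inter_insert_of_notMem hiS]
    ring
  calc expect w (fun x => (∑ S ∈ T.powerset, (-1) ^ (#T + #S) * avg w S f x) ^ 2)
      = ∑ S ∈ T.powerset, (-1) ^ (#T + #S) *
          ∑ S' ∈ T.powerset, (-1) ^ (#T + #S') * corr w f f (S ∩ S') := by
        simp only [sq, sum_mul_sum]
        rw [expect_sum]
        refine sum_congr rfl fun S _ => ?_
        rw [expect_sum, mul_sum]
        refine sum_congr rfl fun S' _ => ?_
        rw [← expect_avg_mul_avg hw, ← expect_const_mul, ← expect_const_mul]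
        congr 1
        ext x
        ring
    _ = (-1) ^ (#T + #T) *
          ∑ S' ∈ T.powerset, (-1) ^ (#T + #S') * corr w f f (T ∩ S') := by
        refine sum_eq_single_of_mem T (mem_powerset_self T) fun S hS hST => ?_
        rw [hvanish S hS hST, mul_zero]
    _ = level w f f T := by
        rw [Even.neg_one_pow ⟨_, rfl⟩, one_mul]
        refine sum_congr rfl fun S hS => ?_
        rw [inter_eq_right.mpr (mem_powerset.mp hS)]

theorem level_self_nonneg (hw0 : ∀ a, 0 ≤ w a) (hw : ∑ a, w a = 1) (f : (ι → α) → ℝ)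
    (T : Finset ι) : 0 ≤ level w f f T := by
  rw [← expect_sq_eq_level hw, ← expect_const (ι := ι) hw 0]
  exact expect_mono hw0 fun x => sq_nonneg _

theorem sum_level_mul_pow (f g : (ι → α) → ℝ) (t : ℝ) :
    ∑ T, level w f g T * t ^ #T =
      ∑ S, t ^ #S * (1 - t) ^ #Sᶜ * corr w f g S := by
  have hinner : ∀ S : Finset ι,
      ∑ T with S ⊆ T, (-1) ^ (#T + #S) * t ^ #T = t ^ #S * (1 - t) ^ #Sᶜ := by
    intro S
    have hexp : (1 - t) ^ #Sᶜ = ∑ U ∈ Sᶜ.powerset, (-t) ^ #U := by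
      have := sum_pow_mul_eq_add_pow (-t) 1 Sᶜ
      simp only [one_pow, mul_one] at this
      rw [this]
      ring
    rw [hexp, mul_sum]
    refine sum_bij' (fun T _ => T \ S) (fun U _ => S ∪ U) ?_ ?_ ?_ ?_ ?_
    · intro T _
      rw [mem_powerset, subset_compl_iff_disjoint_right]
      exact sdiff_disjoint
    · intro U _
      simp
    · intro T hT
      exact union_sdiff_of_subset (mem_filter.mp hT).2
    · intro U hU
      rw [union_sdiff_cancel_left]
      exact (subset_compl_iff_disjoint_right.mp (mem_powerset.mp hU)).symm
    · intro T hT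
      have hcard := card_sdiff_add_card_eq_card (mem_filter.mp hT).2
      rw [← hcard, neg_pow t]
      rw [show #(T \ S) + #S + #S = #(T \ S) + 2 * #S by ring, pow_add, pow_mul]
      simp
      ring
  simp only [level, sum_mul, ← hinner]
  rw [sum_comm' (t' := univ) (s' := fun S => univ.filter (S ⊆ ·)) (by simp)]
  refine sum_congr rfl fun S _ => sum_congr rfl fun T _ => by ring

theorem level_add_add (f g : (ι → α) → ℝ) (T : Finset ι) (s : ℝ) :
    level w (fun x => f x + s * g x) (fun x => f x + s * g x) T =
      level w f f T + 2 * s * level w f g T + s ^ 2 * level w g g T := by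
  have hcorr : ∀ S, corr w (fun x => f x + s * g x) (fun x => f x + s * g x) S =
      corr w f f S + 2 * s * corr w f g S + s ^ 2 * corr w g g S := by
    intro S
    have hsymm : corr w g f S = corr w f g S := by
      rw [corr_eq_left S f g, corr]
      simp only [mul_comm]
    have havg : ∀ x, avg w S (fun x => f x + s * g x) x = avg w S f x + s * avg w S g x := by
      intro x
      simp only [avg]
      rw [expect_add, expect_const_mul]
    rw [show 2 * s * corr w f g S = s * corr w f g S + s * corr w g f S by rw [hsymm]; ring]
    simp only [corr, havg, ← expect_const_mul, ← expect_add]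
    congr 1
    ext x
    ring
  simp only [level, hcorr, mul_sum, ← sum_add_distrib]
  exact sum_congr rfl fun S _ => by ring

theorem sum_abs_level_le (hw0 : ∀ a, 0 ≤ w a) (hw : ∑ a, w a = 1) (f g : (ι → α) → ℝ)
    (hf : expect w (fun x => f x ^ 2) ≤ 1) (hg : expect w (fun x => g x ^ 2) ≤ 1) :
    ∑ T, |level w f g T| ≤ 1 := by
  have hself : ∀ f : (ι → α) → ℝ, ∑ T, level w f f T = expect w fun x => f x ^ 2 := by
    intro f
    have h := sum_level_mul_pow (w := w) f f 1
    simp only [one_pow, mul_one, one_mul, sub_self] at h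
    rw [h, sum_eq_single univ]
    · simp [corr_univ hw, sq]
    · intro S _ hS
      rw [zero_pow, zero_mul]
      rwa [Ne, card_eq_zero, compl_eq_empty_iff]
    · simp
  have hT : ∀ T, |level w f g T| ≤ (level w f f T + level w g g T) / 2 := by
    intro T
    have h1 := level_self_nonneg hw0 hw (fun x => f x + 1 * g x) T
    have h2 := level_self_nonneg hw0 hw (fun x => f x + -1 * g x) T
    rw [level_add_add] at h1 h2
    rw [abs_le]
    constructor <;> linarith
  calc ∑ T, |level w f g T| ≤ ∑ T, (level w f f T + level w g g T) / 2 :=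
        sum_le_sum fun T _ => hT T
    _ ≤ 1 := by
        rw [← sum_div, sum_add_distrib, hself, hself]
        linarith

/-- The FKG inequality for product weights. -/
theorem expect_mul_le [LinearOrder α] (hw0 : ∀ a, 0 ≤ w a) (hw : ∑ a, w a = 1)
    {f g : (ι → α) → ℝ} (hf : Monotone f) (hg : Monotone g) :
    expect w f * expect w g ≤ expect w fun x => f x * g x := by
  obtain ⟨a, ha⟩ := (Set.finite_range f).bddBelow
  obtain ⟨b, hb⟩ := (Set.finite_range g).bddBelow
  have hsum : ∑ x : ι → α, ∏ i, w (x i) = 1 := by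
    simpa [expect] using expect_const (ι := ι) hw 1
  have key := fkg (μ := fun x : ι → α => ∏ i, w (x i)) (f := fun x => f x + -a)
    (g := fun x => g x + -b)
    (fun x => prod_nonneg fun i _ => hw0 _)
    (fun x => by simpa using ha ⟨x, rfl⟩) (fun x => by simpa using hb ⟨x, rfl⟩)
    (fun x y h => by simpa using hf h) (fun x y h => by simpa using hg h)
    (fun x y => by
      rw [← prod_mul_distrib, ← prod_mul_distrib]
      refine (prod_congr rfl fun i _ => ?_).le
      rcases le_total (x i) (y i) with h | h <;> simp [h, mul_comm])
  rw [hsum, one_mul] at key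
  change expect w (fun x => f x + -a) * expect w (fun x => g x + -b) ≤
    expect w (fun x => (f x + -a) * (g x + -b)) at key
  have hprod : expect w (fun x => (f x + -a) * (g x + -b)) =
      expect w (fun x => f x * g x) + -b * expect w f + -a * expect w g + a * b := by
    rw [← expect_const (ι := ι) hw (a * b)]
    simp only [← expect_const_mul, ← expect_add]
    congr 1
    ext x
    ring
  rw [hprod, expect_add, expect_add, expect_const hw, expect_const hw] at key
  linarith

theorem monotone_avg [LinearOrder α] (hw0 : ∀ a, 0 ≤ w a) (S : Finset ι)
    {f : (ι → α) → ℝ} (hf : Monotone f) : Monotone (avg w S f) := fun _ _ hxy =>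
  expect_mono hw0 fun _ => hf (S.piecewise_le_piecewise hxy le_rfl)

theorem corr_empty_le [LinearOrder α] (hw0 : ∀ a, 0 ≤ w a) (hw : ∑ a, w a = 1)
    {f g : (ι → α) → ℝ} (hf : Monotone f) (hg : Monotone g) (S : Finset ι) :
    corr w f g ∅ ≤ corr w f g S := by
  rw [corr_empty, ← expect_avg hw S g]
  exact expect_mul_le hw0 hw hf (monotone_avg hw0 S hg)

theorem corr_le_univ [LinearOrder α] (hw0 : ∀ a, 0 ≤ w a) (hw : ∑ a, w a = 1)
    {f g : (ι → α) → ℝ} (hf : Monotone f) (hg : Monotone g) (S : Finset ι) :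
    corr w f g S ≤ corr w f g univ := by
  rw [corr_univ hw, ← expect_avg hw S (fun x => f x * g x), ← inter_self S,
    ← expect_avg_mul_avg hw, inter_self]
  refine expect_mono hw0 fun x => ?_
  exact expect_mul_le hw0 hw (fun y z h => hf (S.piecewise_le_piecewise le_rfl h))
    (fun y z h => hg (S.piecewise_le_piecewise le_rfl h))

theorem abs_sum_level_sub_le [LinearOrder α] (hw0 : ∀ a, 0 ≤ w a) (hw : ∑ a, w a = 1)
    {f g : (ι → α) → ℝ} (hf : Monotone f) (hg : Monotone g) {t : ℝ} (ht0 : 0 ≤ t)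
    (ht1 : t ≤ 1) :
    |∑ T, level w f g T * t ^ #T - corr w f g ∅| ≤ corr w f g univ - corr w f g ∅ := by
  have hmass : ∑ S : Finset ι, t ^ #S * (1 - t) ^ #Sᶜ = 1 := by
    have := Fintype.sum_pow_mul_eq_add_pow ι t (1 - t)
    simp only [card_compl]
    rw [this]
    simp
  have hrw : ∑ T, level w f g T * t ^ #T - corr w f g ∅ =
      ∑ S, t ^ #S * (1 - t) ^ #Sᶜ * (corr w f g S - corr w f g ∅) := by
    simp only [mul_sub, sum_sub_distrib, ← sum_mul, hmass, one_mul, sum_level_mul_pow]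
  have hcoef : ∀ S : Finset ι, 0 ≤ t ^ #S * (1 - t) ^ #Sᶜ := fun S =>
    mul_nonneg (pow_nonneg ht0 _) (pow_nonneg (by linarith) _)
  rw [hrw, abs_of_nonneg (sum_nonneg fun S _ => mul_nonneg (hcoef S)
    (sub_nonneg.mpr (corr_empty_le hw0 hw hf hg S)))]
  calc ∑ S, t ^ #S * (1 - t) ^ #Sᶜ * (corr w f g S - corr w f g ∅)
      ≤ ∑ S, t ^ #S * (1 - t) ^ #Sᶜ * (corr w f g univ - corr w f g ∅) :=
        sum_le_sum fun S _ => mul_le_mul_of_nonneg_left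
          (sub_le_sub_right (corr_le_univ hw0 hw hf hg S) _) (hcoef S)
    _ = corr w f g univ - corr w f g ∅ := by rw [← sum_mul, hmass, one_mul]

theorem sum_level_card_one (hw : ∑ a, w a = 1) (f g : (ι → α) → ℝ) :
    ∑ T with #T = 1, level w f g T =
      ∑ i, expect w fun x => (expect w (fun y => f (Function.update y i (x i))) - expect w f) *
        (expect w (fun y => g (Function.update y i (x i))) - expect w g) := by
  have hsingle : ∑ T with #T = 1, level w f g T = ∑ i, level w f g {i} := by
    symm
    refine sum_bij (fun i _ => {i}) (by simp) (by simp) ?_ (by simp)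
    intro T hT
    obtain ⟨i, rfl⟩ := card_eq_one.mp (mem_filter.mp hT).2
    exact ⟨i, mem_univ i, rfl⟩
  rw [hsingle]
  refine sum_congr rfl fun i _ => ?_
  have hlevel : level w f g {i} = corr w f g {i} - corr w f g ∅ := by
    rw [level, ← insert_empty_eq, sum_powerset_insert (notMem_empty i)]
    simp
    ring
  have havg : ∀ (f : (ι → α) → ℝ) x,
      expect w (fun y => f (Function.update y i (x i))) = avg w {i} f x := by
    intro f x
    simp only [avg, piecewise_singleton]
  simp only [havg]
  have hcov : expect w (fun x => (avg w {i} f x - expect w f) * (avg w {i} g x - expect w g)) =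
      expect w (fun x => avg w {i} f x * avg w {i} g x) +
        -expect w g * expect w (avg w {i} f) + -expect w f * expect w (avg w {i} g) +
        expect w (fun _ : ι → α => expect w f * expect w g) := by
    generalize expect w f = a, expect w g = b
    simp only [← expect_const_mul, ← expect_add]
    congr 1
    ext x
    ring
  rw [hcov, hlevel, corr_empty, expect_avg_mul_avg hw, inter_self, expect_avg hw, expect_avg hw,
    expect_const hw]
  ring

end ProductWeight

/-- Quantitative FKG inequality over finite product spaces: for monotone
`f, g : {0,…,m-1}^n → ℝ` with `E[f²], E[g²] ≤ 1` under a full-support product measure,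
`E[fg] - E[f]E[g] ≥ (1/C)·Φ(∑_i E[f^{={i}} g^{={i}}])` for a universal constant `C > 0`,
where `f^{={i}}(x) = f_i(x_i) - E[f]` is the singleton Efron–Stein component. -/
theorem stmt13 :
    ∃ C : ℝ, 0 < C ∧ ∀ (m n : ℕ) (w : Fin m → ℝ), (∀ a, 0 < w a) → (∑ a, w a = 1) →
      ∀ f g : (Fin n → Fin m) → ℝ, Monotone f → Monotone g →
      (∑ x, (∏ i, w (x i)) * (f x) ^ 2) ≤ 1 → (∑ x, (∏ i, w (x i)) * (g x) ^ 2) ≤ 1 →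
      (1 / C) * Phi (∑ i : Fin n, ∑ x : Fin n → Fin m, (∏ j, w (x j)) *
          (((∑ y : Fin n → Fin m, (∏ j, w (y j)) * f (Function.update y i (x i)))
              - ∑ y : Fin n → Fin m, (∏ j, w (y j)) * f y) *
           ((∑ y : Fin n → Fin m, (∏ j, w (y j)) * g (Function.update y i (x i)))
              - ∑ y : Fin n → Fin m, (∏ j, w (y j)) * g y)))
        ≤ (∑ x, (∏ i, w (x i)) * (f x * g x))
          - (∑ x, (∏ i, w (x i)) * f x) * (∑ x, (∏ i, w (x i)) * g x) := by
  refine ⟨2048, by norm_num, fun m n w hw0 hw f g hf hg hf2 hg2 => ?_⟩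
  have hw0' : ∀ a, 0 ≤ w a := fun a => (hw0 a).le
  have h := Phi_linear_coeff_le (ProductWeight.level w f g) Finset.card
    (ProductWeight.corr w f g ∅) _ (ProductWeight.sum_abs_level_le hw0' hw f g hf2 hg2)
    (fun t ht => ProductWeight.abs_sum_level_sub_le hw0' hw hf hg ht.1
      (ht.2.trans (by norm_num)))
  rw [ProductWeight.sum_level_card_one hw, ProductWeight.corr_univ hw,
    ProductWeight.corr_empty] at h
  rw [one_div, inv_mul_le_iff₀ (by norm_num)]
  exact h
end

section
/- Let f : [0,1] \to \R be monotone nondecreasing and bounded, and let B^R_t denote reflected Brownian motion on [0,1] started at x (the reflection of standard Brownian motion into [0,1]). Then the function x \mapsto E[f(x + \sqrt{2} B^R_t)] is monotone nondecreasing in x for each fixed t \ge 0. -/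
open MeasureTheory ProbabilityTheory

/-- The folding (reflection) map `ℝ → [0,1]`: `reflect y = y - ⌊y⌋` if `⌊y⌋` is even,
and `1 - (y - ⌊y⌋)` if `⌊y⌋` is odd. Reflected Brownian motion on `[0,1]` started at `x`
is `reflect (x + B_t)` for standard Brownian motion `B_t`. -/
noncomputable def reflect (y : ℝ) : ℝ :=
  if Even ⌊y⌋ then y - ⌊y⌋ else 1 - (y - ⌊y⌋)

/-- The Gaussian averaging operator of variance `v`. -/
noncomputable def gaussianAverage (v : NNReal) (F : ℝ → ℝ) (x : ℝ) : ℝ :=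
  ∫ z, F (x + z) ∂(gaussianReal 0 v)

/-- Bounded measurable functions which are even and `2`-periodic, and which are nondecreasing
on `[0,1]` up to an error `δ`. -/
structure IsFoldedAlmostMonotone (F : ℝ → ℝ) (C δ : ℝ) : Prop where
  measurable : Measurable F
  bound : ∀ x, |F x| ≤ C
  even : ∀ x, F (-x) = F x
  periodic : ∀ x, F (x + 2) = F x
  le_add : ∀ x y, 0 ≤ x → x ≤ y → y ≤ 1 → F x ≤ F y + δ

lemma Measurable.integrable_of_abs_le {μ : Measure ℝ} [IsFiniteMeasure μ] {G : ℝ → ℝ} {C : ℝ}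
    (hG : Measurable G) (hb : ∀ x, |G x| ≤ C) : Integrable G μ :=
  Integrable.of_bound hG.aestronglyMeasurable C (Filter.Eventually.of_forall hb)

lemma integral_gaussianReal_eq_integral_add (m : ℝ) (v : NNReal) {G : ℝ → ℝ} (hG : Measurable G) :
    ∫ w, G w ∂(gaussianReal m v) = ∫ z, G (m + z) ∂(gaussianReal 0 v) := by
  have h := gaussianReal_map_const_add (μ := 0) (v := v) m
  rw [zero_add] at h
  rw [← h, integral_map (by fun_prop) hG.aestronglyMeasurable]

lemma integral_gaussianReal_zero_neg (v : NNReal) {G : ℝ → ℝ} (hG : Measurable G) :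
    ∫ z, G (-z) ∂(gaussianReal 0 v) = ∫ z, G z ∂(gaussianReal 0 v) := by
  have h := gaussianReal_map_neg (μ := 0) (v := v)
  rw [neg_zero] at h
  conv_rhs => rw [← h]
  rw [integral_map (by fun_prop) hG.aestronglyMeasurable]

lemma integral_pow_four_gaussianReal (v : NNReal) :
    ∫ z, z ^ 4 ∂(gaussianReal 0 v) = (v : ℝ) ^ 2 * ∫ z, z ^ 4 ∂(gaussianReal 0 1) := by
  have h := gaussianReal_map_const_mul (μ := 0) (v := 1) (√(v : ℝ))
  have hv : NNReal.mk ((√(v : ℝ)) ^ 2) (sq_nonneg _) * 1 = v := by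
    ext
    simp
  rw [mul_zero, hv] at h
  conv_lhs => rw [← h]
  rw [integral_map (by fun_prop) (by fun_prop), ← integral_const_mul]
  congr 1 with z
  rw [mul_pow, show (√(v : ℝ)) ^ 4 = ((√(v : ℝ)) ^ 2) ^ 2 by ring, Real.sq_sqrt v.coe_nonneg]

lemma integrable_pow_four_gaussianReal (m : ℝ) (v : NNReal) (a : ℝ) :
    Integrable (fun z => (z - a) ^ 4) (gaussianReal m v) := by
  have h : MemLp (fun z : ℝ => z - a) 4 (gaussianReal m v) :=
    (memLp_id_gaussianReal' 4 (by simp)).sub (memLp_const a)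
  have := h.integrable_norm_pow (p := 4) (by norm_num)
  refine this.congr (Filter.Eventually.of_forall fun z => ?_)
  simp only [Real.norm_eq_abs]
  exact Even.pow_abs (by decide) _

/-- Comparison of integrals against two nondegenerate Gaussians by comparison of the densities. -/
lemma integral_gaussianReal_mono {m n : ℝ} {v : NNReal} (hv : v ≠ 0) {A B : ℝ → ℝ}
    (hA : Integrable A (gaussianReal m v)) (hB : Integrable B (gaussianReal n v))
    (h : ∀ w, gaussianPDFReal n v w * B w ≤ gaussianPDFReal m v w * A w) :
    ∫ w, B w ∂(gaussianReal n v) ≤ ∫ w, A w ∂(gaussianReal m v) := by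
  have key : ∀ (m : ℝ) {G : ℝ → ℝ}, Integrable G (gaussianReal m v) →
      Integrable fun w => gaussianPDFReal m v w • G w := by
    intro m G hG
    rw [gaussianReal_of_var_ne_zero m hv, integrable_withDensity_iff_integrable_smul'
      (measurable_gaussianPDF m v) (by simp [gaussianPDF])] at hG
    simpa using hG
  rw [integral_gaussianReal_eq_integral_smul hv, integral_gaussianReal_eq_integral_smul hv]
  exact integral_mono (key n hB) (key m hA) h

lemma gaussianPDFReal_neg_le {d w : ℝ} (v : NNReal) (h : 0 ≤ d * w) :
    gaussianPDFReal (-d) v w ≤ gaussianPDFReal d v w := by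
  rw [gaussianPDFReal_def, gaussianPDFReal_def]
  dsimp only
  refine mul_le_mul_of_nonneg_left (Real.exp_le_exp.2 ?_) (by positivity)
  exact div_le_div_of_nonneg_right (by linarith) (by positivity)

namespace IsFoldedAlmostMonotone

variable {F : ℝ → ℝ} {C δ : ℝ}

lemma integrable (hF : IsFoldedAlmostMonotone F C δ) (μ : Measure ℝ) [IsFiniteMeasure μ] (x : ℝ) :
    Integrable (fun z => F (x + z)) μ :=
  (hF.measurable.comp (measurable_const_add x)).integrable_of_abs_le fun _ => hF.bound _

/-- Reflecting across a point of `[0,1]` at distance at most `1` orders the values of `F`. -/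
lemma sub_le_add (hF : IsFoldedAlmostMonotone F C δ) {m w : ℝ} (hm : m ∈ Set.Icc (0 : ℝ) 1)
    (hw : w ∈ Set.Icc (0 : ℝ) 1) : F (m - w) ≤ F (m + w) + δ := by
  obtain ⟨hm0, hm1⟩ := hm
  obtain ⟨hw0, hw1⟩ := hw
  have h1 : F (m - w) = F |m - w| := by
    rcases abs_choice (m - w) with h | h <;> rw [h]
    rw [hF.even]
  rw [h1]
  rcases le_total (m + w) 1 with h | h
  · exact hF.le_add _ _ (abs_nonneg _) (abs_le.2 ⟨by linarith, by linarith⟩) h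
  · have h2 : F (m + w) = F (2 - (m + w)) := by
      rw [← hF.even (m + w), ← hF.periodic]
      ring_nf
    rw [h2]
    exact hF.le_add _ _ (abs_nonneg _) (abs_le.2 ⟨by linarith, by linarith⟩) (by linarith)

/-- Almost monotonicity of the Gaussian average, by reflection across the midpoint of the two
starting points; the error comes from the event that the Gaussian has size at least `1 / 2`. -/
lemma gaussianAverage_le_add (hF : IsFoldedAlmostMonotone F C δ) (hδ : 0 ≤ δ) {v : NNReal}
    (hv : v ≠ 0) {x y : ℝ} (hx : 0 ≤ x) (hxy : x ≤ y) (hy : y ≤ 1) :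
    gaussianAverage v F x ≤
      gaussianAverage v F y + (δ + 32 * C * ∫ z, z ^ 4 ∂(gaussianReal 0 v)) := by
  have hC : 0 ≤ C := (abs_nonneg _).trans (hF.bound 0)
  obtain ⟨m, hm⟩ : ∃ m, m = (x + y) / 2 := ⟨_, rfl⟩
  obtain ⟨d, hd⟩ : ∃ d, d = (y - x) / 2 := ⟨_, rfl⟩
  have hm01 : m ∈ Set.Icc (0 : ℝ) 1 := ⟨by linarith, by linarith⟩
  have hd0 : 0 ≤ d := by linarith
  have hd1 : d ≤ 1 / 2 := by linarith
  have hFm := hF.measurable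
  have hplus (n : ℝ) : ∫ w, F (m + w) ∂(gaussianReal n v) = gaussianAverage v F (m + n) := by
    rw [integral_gaussianReal_eq_integral_add n v (G := fun w => F (m + w)) (by fun_prop)]
    simp only [gaussianAverage, add_assoc]
  have hminus (n : ℝ) : ∫ w, F (m - w) ∂(gaussianReal n v) = gaussianAverage v F (m - n) := by
    rw [integral_gaussianReal_eq_integral_add n v (G := fun w => F (m - w)) (by fun_prop),
      ← integral_gaussianReal_zero_neg v (by fun_prop)]
    simp only [gaussianAverage]
    congr 1 with z
    ring_nf
  have hpow (n : ℝ) : ∫ w, (w - n) ^ 4 ∂(gaussianReal n v) = ∫ z, z ^ 4 ∂(gaussianReal 0 v) := by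
    rw [integral_gaussianReal_eq_integral_add n v (G := fun w => (w - n) ^ 4) (by fun_prop)]
    simp
  have hiplus (n : ℝ) : Integrable (fun w => F (m + w)) (gaussianReal n v) := hF.integrable _ m
  have himinus (n : ℝ) : Integrable (fun w => F (m - w)) (gaussianReal n v) :=
    Measurable.integrable_of_abs_le (by fun_prop) fun _ => hF.bound _
  have hipow (n : ℝ) : Integrable (fun w => δ + 32 * C * (w - n) ^ 4) (gaussianReal n v) :=
    (integrable_const δ).add ((integrable_pow_four_gaussianReal n v n).const_mul _)
  have herr (n : ℝ) : ∫ w, (δ + 32 * C * (w - n) ^ 4) ∂(gaussianReal n v) =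
      δ + 32 * C * ∫ z, z ^ 4 ∂(gaussianReal 0 v) := by
    rw [integral_add (integrable_const δ)
      ((integrable_pow_four_gaussianReal n v n).const_mul _), integral_const_mul, ← hpow n]
    simp
  have hidiff (n : ℝ) : Integrable (fun w => F (m + w) - F (m - w)) (gaussianReal n v) :=
    (hiplus n).sub (himinus n)
  have hmain := integral_gaussianReal_mono (m := d) (n := -d) hv
    (A := fun w => (F (m + w) - F (m - w)) + (δ + 32 * C * (w - d) ^ 4))
    (B := fun w => (F (m + w) - F (m - w)) - (δ + 32 * C * (w - -d) ^ 4))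
    ((hidiff d).add (hipow d))
    ((hidiff (-d)).sub (hipow (-d))) ?_
  · rw [integral_sub (hidiff (-d)) (hipow (-d)),
      integral_add (hidiff d) (hipow d), integral_sub (hiplus d) (himinus d),
      integral_sub (hiplus (-d)) (himinus (-d)), herr, herr, hplus, hplus, hminus, hminus,
      show m + d = y by linarith, show m - d = x by linarith, show m + -d = x by linarith,
      show m - -d = y by linarith] at hmain
    linarith
  · intro w
    have hp := gaussianPDFReal_nonneg d v w
    have hq := gaussianPDFReal_nonneg (-d) v w
    have hE : 0 ≤ C * (w - d) ^ 4 := by positivity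
    have hE' : 0 ≤ C * (w - -d) ^ 4 := by positivity
    rcases le_or_gt |w| 1 with hw | hw
    · rw [abs_le] at hw
      have hpE := mul_nonneg hp hE
      have hqE := mul_nonneg hq hE'
      rcases le_total 0 w with h0 | h0
      · have hH := hF.sub_le_add hm01 ⟨h0, hw.2⟩
        have hpq := gaussianPDFReal_neg_le v (mul_nonneg hd0 h0)
        nlinarith [mul_nonneg (sub_nonneg.2 hpq) (sub_nonneg.2 hH), mul_nonneg hq hδ]
      · have hH := hF.sub_le_add hm01 (w := -w) ⟨by linarith, by linarith⟩
        rw [sub_neg_eq_add, ← sub_eq_add_neg] at hH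
        have hpq := gaussianPDFReal_neg_le (d := -d) (w := w) v (by nlinarith)
        rw [neg_neg] at hpq
        nlinarith [mul_nonneg (sub_nonneg.2 hpq) (sub_nonneg.2 hH), mul_nonneg hp hδ]
    · have h1 := abs_le.1 (hF.bound (m + w))
      have h2 := abs_le.1 (hF.bound (m - w))
      have hfar {a : ℝ} (ha : |a| ≤ 1 / 2) : 2 * C ≤ 32 * C * (w - a) ^ 4 := by
        have h3 : (1 / 2 : ℝ) ≤ |w - a| := by linarith [abs_sub_abs_le_abs_sub w a]
        have h4 : (1 / 2 : ℝ) ^ 4 ≤ |w - a| ^ 4 := by gcongr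
        rw [Even.pow_abs (by decide)] at h4
        nlinarith
      have h3 := hfar (a := d) (by rwa [abs_of_nonneg hd0])
      have h4 := hfar (a := -d) (by rwa [abs_neg, abs_of_nonneg hd0])
      calc _ ≤ 0 := mul_nonpos_of_nonneg_of_nonpos hq (by linarith)
        _ ≤ _ := mul_nonneg hp (by linarith)

lemma gaussianAverage (hF : IsFoldedAlmostMonotone F C δ) (hδ : 0 ≤ δ) {v : NNReal}
    (hv : v ≠ 0) :
    IsFoldedAlmostMonotone (gaussianAverage v F) C
      (δ + 32 * C * ∫ z, z ^ 4 ∂(gaussianReal 0 v)) where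
  measurable := by
    have h : StronglyMeasurable (fun p : ℝ × ℝ => F (p.1 + p.2)) :=
      (hF.measurable.comp (by fun_prop)).stronglyMeasurable
    exact h.integral_prod_right'.measurable
  bound x := by
    have h := norm_integral_le_of_norm_le_const (μ := gaussianReal 0 v) (f := fun z => F (x + z))
      (C := C) (Filter.Eventually.of_forall fun z => hF.bound _)
    simpa [_root_.gaussianAverage] using h
  even x := by
    have hFm := hF.measurable
    simp only [_root_.gaussianAverage]
    rw [← integral_gaussianReal_zero_neg v (by fun_prop)]
    congr 1 with z
    rw [← hF.even]
    ring_nf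
  periodic x := by
    simp only [_root_.gaussianAverage]
    congr 1 with z
    rw [← hF.periodic (x + z)]
    ring_nf
  le_add _ _ hx hxy hy := hF.gaussianAverage_le_add hδ hv hx hxy hy

end IsFoldedAlmostMonotone

lemma gaussianAverage_zero (F : ℝ → ℝ) : gaussianAverage 0 F = F := by
  ext x
  simp [gaussianAverage]

lemma gaussianAverage_add (u v : NNReal) {F : ℝ → ℝ} {C : ℝ} (hF : Measurable F)
    (hb : ∀ x, |F x| ≤ C) :
    gaussianAverage (u + v) F = gaussianAverage v (gaussianAverage u F) := by
  ext x
  have h := gaussianReal_conv_gaussianReal (m₁ := 0) (m₂ := 0) (v₁ := v) (v₂ := u)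
  rw [add_zero, add_comm v u] at h
  have hFx : Measurable fun z => F (x + z) := hF.comp (measurable_const_add x)
  simp only [gaussianAverage]
  rw [← h, Measure.conv, integral_map (by fun_prop) hFx.aestronglyMeasurable,
    integral_prod]
  · simp only [add_assoc]
  · exact Integrable.of_bound (hFx.comp measurable_add).aestronglyMeasurable C
      (Filter.Eventually.of_forall fun _ => hb _)

lemma IsFoldedAlmostMonotone.gaussianAverage_nsmul {F : ℝ → ℝ} {C : ℝ}
    (hF : IsFoldedAlmostMonotone F C 0) {v : NNReal} (hv : v ≠ 0) (k : ℕ) :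
    IsFoldedAlmostMonotone (_root_.gaussianAverage (k * v) F) C
      (k * (32 * C * ∫ z, z ^ 4 ∂(gaussianReal 0 v))) := by
  have hC : 0 ≤ C := (abs_nonneg _).trans (hF.bound 0)
  have hM : 0 ≤ ∫ z, z ^ 4 ∂(gaussianReal 0 v) := integral_nonneg fun z => by positivity
  induction k with
  | zero => simpa [gaussianAverage_zero] using hF
  | succ k ih =>
    have h := ih.gaussianAverage (by positivity) hv
    rw [← gaussianAverage_add _ _ hF.measurable hF.bound] at h
    convert h using 1
    · push_cast
      ring_nf
    · push_cast
      ring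

/-- Gaussian averaging preserves exact monotonicity on `[0,1]` of even `2`-periodic functions:
split it into `n` averages of variance `v / n`, whose total error is of order `1 / n`. -/
lemma IsFoldedAlmostMonotone.gaussianAverage_mono {F : ℝ → ℝ} {C : ℝ}
    (hF : IsFoldedAlmostMonotone F C 0) (v : NNReal) {x y : ℝ} (hx : 0 ≤ x) (hxy : x ≤ y)
    (hy : y ≤ 1) : _root_.gaussianAverage v F x ≤ _root_.gaussianAverage v F y := by
  rcases eq_or_ne v 0 with rfl | hv
  · simpa [gaussianAverage_zero] using hF.le_add x y hx hxy hy
  have hbound (n : ℕ) : _root_.gaussianAverage v F x ≤ _root_.gaussianAverage v F y +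
      32 * C * v ^ 2 * (∫ z, z ^ 4 ∂(gaussianReal 0 1)) * (1 / ((n : ℝ) + 1)) := by
    have h := (hF.gaussianAverage_nsmul (v := v / (n + 1 : ℕ))
      (div_ne_zero hv (by positivity)) (n + 1)).le_add x y hx hxy hy
    rw [mul_div_cancel₀ v (by positivity), integral_pow_four_gaussianReal] at h
    convert h using 2
    push_cast
    field_simp
  have hlim := (tendsto_one_div_add_atTop_nhds_zero_nat (𝕜 := ℝ)).const_mul
    (32 * C * v ^ 2 * (∫ z, z ^ 4 ∂(gaussianReal 0 1)))
  have hlim' := hlim.const_add (_root_.gaussianAverage v F y)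
  rw [mul_zero, add_zero] at hlim'
  exact ge_of_tendsto' hlim' hbound

lemma reflect_mem_Icc (y : ℝ) : reflect y ∈ Set.Icc (0 : ℝ) 1 := by
  have h1 := Int.floor_le y
  have h2 := Int.lt_floor_add_one y
  unfold reflect
  split_ifs <;> constructor <;> linarith

lemma reflect_eq_self {y : ℝ} (hy : y ∈ Set.Icc (0 : ℝ) 1) : reflect y = y := by
  rcases hy.2.lt_or_eq with h | rfl
  · have h0 : ⌊y⌋ = 0 := Int.floor_eq_zero_iff.2 ⟨hy.1, h⟩
    simp [reflect, h0]
  · simp [reflect]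

lemma reflect_add_two (y : ℝ) : reflect (y + 2) = reflect y := by
  have h : ⌊y + 2⌋ = ⌊y⌋ + 2 := Int.floor_add_ofNat y 2
  have he : Even (⌊y⌋ + 2) ↔ Even ⌊y⌋ := by simp
  simp only [reflect, h, he]
  push_cast
  congr 1 <;> ring

lemma reflect_neg (y : ℝ) : reflect (-y) = reflect y := by
  have hfl := Int.floor_le y
  have hlt := Int.lt_floor_add_one y
  rcases hfl.eq_or_lt with h | h
  · have hn : ⌊-y⌋ = -⌊y⌋ := by
      rw [← h]
      simp [← Int.cast_neg]
    simp only [reflect, hn, even_neg]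
    push_cast
    rw [h]
    congr 1 <;> ring
  · have hn : ⌊-y⌋ = -⌊y⌋ - 1 := by
      rw [Int.floor_eq_iff]
      push_cast
      constructor <;> linarith
    have he : Even (-⌊y⌋ - 1) ↔ ¬ Even ⌊y⌋ := by simp
    simp only [reflect, hn, he]
    push_cast
    split_ifs <;> ring

lemma measurable_reflect : Measurable reflect := by
  have hs : MeasurableSet {y : ℝ | Even ⌊y⌋} :=
    Int.measurable_floor (MeasurableSet.of_discrete (s := {n : ℤ | Even n}))
  exact Measurable.ite hs (by fun_prop) (by fun_prop)

lemma MonotoneOn.measurable_comp_reflect {f : ℝ → ℝ} (hf : MonotoneOn f (Set.Icc 0 1)) :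
    Measurable fun y => f (reflect y) := by
  have hm : Monotone (Set.IccExtend (zero_le_one' ℝ) fun z => f z) :=
    Monotone.IccExtend _ fun a b hab => hf a.2 b.2 hab
  convert hm.measurable.comp measurable_reflect using 1
  ext y
  simp [Set.IccExtend_of_mem _ _ (reflect_mem_Icc y)]

/-- The reflected heat semigroup preserves monotonicity: if `f : [0,1] → ℝ` is monotone
nondecreasing and bounded, then `x ↦ E[f(x + √2 B^R_t)] = E_{z ~ N(0,t)}[f(reflect(x + √2 z))]`
is monotone nondecreasing on `[0,1]` for each fixed `t ≥ 0`. -/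
theorem stmt18 (f : ℝ → ℝ) (hf : MonotoneOn f (Set.Icc 0 1))
    (C : ℝ) (hb : ∀ y ∈ Set.Icc (0:ℝ) 1, |f y| ≤ C) (t : NNReal) :
    MonotoneOn
      (fun x => ∫ z, f (reflect (x + Real.sqrt 2 * z)) ∂(gaussianReal 0 t))
      (Set.Icc (0:ℝ) 1) := by
  have hF : IsFoldedAlmostMonotone (fun y => f (reflect y)) C 0 :=
    { measurable := hf.measurable_comp_reflect
      bound := fun y => hb _ (reflect_mem_Icc y)
      even := fun y => by rw [reflect_neg]
      periodic := fun y => by rw [reflect_add_two]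
      le_add := fun x y hx hxy hy => by
        have hx' : x ∈ Set.Icc (0 : ℝ) 1 := ⟨hx, hxy.trans hy⟩
        have hy' : y ∈ Set.Icc (0 : ℝ) 1 := ⟨hx.trans hxy, hy⟩
        simpa [reflect_eq_self hx', reflect_eq_self hy'] using hf hx' hy' hxy }
  have hscale (x : ℝ) : ∫ z, f (reflect (x + √2 * z)) ∂(gaussianReal 0 t) =
      gaussianAverage (.mk (√2 ^ 2) (sq_nonneg _) * t) (fun y => f (reflect y)) x := by
    have hmap := gaussianReal_map_const_mul (μ := 0) (v := t) (√2)
    rw [mul_zero] at hmap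
    have hFm : Measurable fun z => f (reflect (x + z)) :=
      hF.measurable.comp (measurable_const_add x)
    rw [gaussianAverage, ← hmap, integral_map (by fun_prop) hFm.aestronglyMeasurable]
  intro x hx y hy hxy
  simp only [hscale]
  exact hF.gaussianAverage_mono _ hx.1 hxy hy.2
end
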